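/- Let 0<r<1 and let T be a bounded linear operator on a complex Hilbert space H belonging to the class C_α, with defect operator D. Then for every x ∈ H the series ∑_{n=0}^{∞} ‖DTⁿx‖² converges and ∑_{n=0}^{∞} ‖DTⁿx‖² = ‖Tx‖² − r²‖x‖² + (r²−1)·L⁺(T,x). -/

import Mathlib

open ContinuousLinearMap Filter

/-- The operator `α(T*,T) = -T*²T² + (1+r²)T*T - r²I`. -/
noncomputable def alphaOp {H : Type*} [NormedAddCommGroup H] [InnerProductSpace ℂ H]
    [CompleteSpace H] (r : ℝ) (T : H →L[ℂ] H) : H →L[ℂ] H :=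
  -((adjoint T) ^ 2 * T ^ 2) + ((1 + r ^ 2 : ℝ) : ℂ) • (adjoint T * T)
    - ((r ^ 2 : ℝ) : ℂ) • (1 : H →L[ℂ] H)

lemma aux_mul {H : Type*} [NormedAddCommGroup H] [InnerProductSpace ℂ H]
    (A B : H →L[ℂ] H) (y : H) : (A * B) y = A (B y) := rfl

lemma aux_one {H : Type*} [NormedAddCommGroup H] [InnerProductSpace ℂ H]
    (y : H) : (1 : H →L[ℂ] H) y = y := rfl

lemma aux_norm {H : Type*} [NormedAddCommGroup H] [InnerProductSpace ℂ H] [CompleteSpace H]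
    (r : ℝ) (T D : H →L[ℂ] H) (hDpos : D.IsPositive) (hDsq : D * D = alphaOp r T) (y : H) :
    ‖D y‖ ^ 2 = (1 + r ^ 2) * ‖T y‖ ^ 2 - ‖T (T y)‖ ^ 2 - r ^ 2 * ‖y‖ ^ 2 := by
  have h1 : inner ℂ (D y) (D y) = inner ℂ y ((D * D) y) := by
    have h := hDpos.isSelfAdjoint.adjoint_eq
    rw [aux_mul, ← adjoint_inner_left D (D y) y, h]
  rw [hDsq] at h1
  simp only [alphaOp, sub_apply, add_apply, neg_apply, smul_apply, aux_mul, pow_two,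
    aux_one, inner_sub_right, inner_add_right, inner_neg_right, inner_smul_right,
    adjoint_inner_right, inner_self_eq_norm_sq_to_K] at h1
  have h2 := congrArg Complex.re h1
  norm_cast at h2
  simp at h2
  norm_cast at h2
  linarith

lemma aux_seq (q : ℝ) (hq0 : 0 < q) (hq1 : q < 1) (a d : ℕ → ℝ) (ha : ∀ n, 0 ≤ a n)
    (hd : ∀ n, 0 ≤ d n) (h : ∀ n, d n = (1 + q) * a (n + 1) - a (n + 2) - q * a n) :
    ∃ L : ℝ, Tendsto a atTop (nhds L) ∧ HasSum d (a 1 - q * a 0 + (q - 1) * L) := by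
  obtain ⟨C, hC0, hC⟩ : ∃ C : ℝ, 0 ≤ C ∧ a 1 - a 0 ≤ C := ⟨|a 1 - a 0|, abs_nonneg _, le_abs_self _⟩
  have hc : ∀ n, a (n + 1) - a n ≤ C * q ^ n := by
    intro n
    induction n with
    | zero => simpa using hC
    | succ n ih =>
      have h1 := hd n
      rw [h n] at h1
      have h2 := mul_le_mul_of_nonneg_left ih hq0.le
      rw [pow_succ]
      show a (n + 2) - a (n + 1) ≤ _
      linarith
  have hq : 0 < 1 - q := by linarith
  have hanti : Antitone (fun n => a n + C / (1 - q) * q ^ n) := by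
    apply antitone_nat_of_succ_le
    intro n
    have h1 := hc n
    have h2 : C * q ^ n = C / (1 - q) * q ^ n - C / (1 - q) * q ^ (n + 1) := by
      field_simp
      ring
    linarith
  have hbdd : BddBelow (Set.range (fun n => a n + C / (1 - q) * q ^ n)) := by
    refine ⟨0, ?_⟩
    rintro _ ⟨n, rfl⟩
    have := ha n
    positivity
  have ht := tendsto_atTop_ciInf hanti hbdd
  have hp : Tendsto (fun n : ℕ => C / (1 - q) * q ^ n) atTop (nhds (C / (1 - q) * 0)) :=
    (tendsto_pow_atTop_nhds_zero_of_lt_one hq0.le hq1).const_mul _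
  obtain ⟨L, hL⟩ : ∃ L, Tendsto a atTop (nhds L) := ⟨_, by simpa using ht.sub hp⟩
  refine ⟨L, hL, ?_⟩
  rw [hasSum_iff_tendsto_nat_of_nonneg hd]
  have hs : ∀ n, ∑ i ∈ Finset.range n, d i = a 1 - q * a 0 - (a (n + 1) - q * a n) := by
    intro n
    induction n with
    | zero => simp
    | succ n ih =>
      rw [Finset.sum_range_succ, ih, h n]
      ring
  simp only [hs]
  have := (((tendsto_add_atTop_iff_nat 1).2 hL).sub (hL.const_mul q)).const_sub (a 1 - q * a 0)
  convert this using 2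
  ring

/-- if `T ∈ C_α` (invertible with `α(T*,T) ≥ 0`) with defect operator `D`
(the positive square root of `α(T*,T)`), then for every `x` the series `∑ₙ ‖DTⁿx‖²`
converges and equals `‖Tx‖² - r²‖x‖² + (r²-1)·L⁺(T,x)`, where
`L⁺(T,x) = lim ‖Tⁿx‖²`. -/
theorem stmt4 {H : Type*} [NormedAddCommGroup H] [InnerProductSpace ℂ H] [CompleteSpace H]
    (r : ℝ) (hr0 : 0 < r) (hr1 : r < 1)
    (T S D : H →L[ℂ] H) (hTS : T * S = 1) (hST : S * T = 1)
    (hDpos : D.IsPositive) (hDsq : D * D = alphaOp r T) :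
    ∀ x : H, ∃ L : ℝ,
      Tendsto (fun n : ℕ => ‖(T ^ n) x‖ ^ 2) atTop (nhds L) ∧
      HasSum (fun n : ℕ => ‖D ((T ^ n) x)‖ ^ 2)
        (‖T x‖ ^ 2 - r ^ 2 * ‖x‖ ^ 2 + (r ^ 2 - 1) * L) := by
  intro x
  obtain ⟨L, hL, hs⟩ := aux_seq (r ^ 2) (by positivity) (by nlinarith)
    (fun n => ‖(T ^ n) x‖ ^ 2) (fun n => ‖D ((T ^ n) x)‖ ^ 2)
    (fun n => by positivity) (fun n => by positivity)
    (fun n => by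
      have h := aux_norm r T D hDpos hDsq ((T ^ n) x)
      have e : ∀ m, (T ^ (m + 1)) x = T ((T ^ m) x) := fun m => by
        rw [pow_succ', aux_mul]
      simp only [e]
      exact h)
  exact ⟨L, hL, by simpa using hs⟩
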